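/- arXiv:1205.1147 — 2 statements merged into one kernel-verified Lean document; each statement's English description precedes it below -/
import Mathlib

section
/- The ring of integers of ℚ(√m) is a principal ideal domain for m = −1, −2, −3, −7, −11, −19, −43, −67, −163. -/
theorem hp_pid_of_dh (K : Type*) [Field K] [NumberField K] (φ : K →+* ℂ)
    (hint : ∀ z : K, IsIntegral ℤ z → ∃ n : ℕ, Complex.normSq (φ z) = n)
    (H : ∀ α : K, ¬ IsIntegral ℤ α → ∃ s t : K, IsIntegral ℤ s ∧ IsIntegral ℤ t ∧
      0 < Complex.normSq (φ (s * α - t)) ∧ Complex.normSq (φ (s * α - t)) < 1) :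
    IsPrincipalIdealRing (NumberField.RingOfIntegers K) := by
  classical
  refine ⟨fun I => ?_⟩
  by_cases hI : I = ⊥
  · subst hI
    exact ⟨0, by simp⟩
  obtain ⟨c, hcI, hc0⟩ := Submodule.exists_mem_ne_zero_of_ne_bot hI
  have hex : ∃ n : ℕ, ∃ b : NumberField.RingOfIntegers K, b ∈ I ∧ b ≠ 0 ∧
      Complex.normSq (φ (b : K)) = n := by
    obtain ⟨n, hn⟩ := hint (c : K) c.2
    exact ⟨n, c, hcI, hc0, hn⟩
  obtain ⟨b, hbI, hb0, hbn⟩ := Nat.find_spec hex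
  have hmin := fun n hn => Nat.find_min hex (m := n) hn
  generalize Nat.find hex = n at hbn hmin
  refine ⟨b, le_antisymm (fun a ha => ?_) ?_⟩
  · have hbK : (b : K) ≠ 0 := by
      simpa using hb0
    by_cases hα : IsIntegral ℤ ((a : K) / b)
    · refine Submodule.mem_span_singleton.2 ⟨⟨_, hα⟩, ?_⟩
      apply NumberField.RingOfIntegers.ext
      change ((a : K) / b) * (b : K) = (a : K)
      field_simp
    · exfalso
      obtain ⟨s, t, hs, ht, h0, h1⟩ := H _ hα
      set d : NumberField.RingOfIntegers K := ⟨s, hs⟩ * a - ⟨t, ht⟩ * b with hd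
      have hdI : d ∈ I := I.sub_mem (I.mul_mem_left _ ha) (I.mul_mem_left _ hbI)
      have hdK : (d : K) = (s * ((a : K) / b) - t) * b := by
        have e : (d : K) = s * (a : K) - t * (b : K) := rfl
        rw [e]
        field_simp
      have hbpos : 0 < Complex.normSq (φ (b : K)) := by
        rw [Complex.normSq_pos]
        simpa using hb0
      have hdn : Complex.normSq (φ (d : K)) =
          Complex.normSq (φ (s * ((a : K) / b) - t)) * Complex.normSq (φ (b : K)) := by
        rw [hdK, map_mul, map_mul]
      obtain ⟨k, hk⟩ := hint (d : K) d.2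
      have hdpos : 0 < Complex.normSq (φ (d : K)) := by rw [hdn]; positivity
      refine hmin k ?_ ⟨d, hdI, ?_, hk⟩
      · have : (k : ℝ) < n := by
          rw [← hk, hdn, ← hbn]
          nlinarith
        exact_mod_cast this
      · intro h
        rw [h] at hdpos
        simp at hdpos
  · exact (Submodule.span_singleton_le_iff_mem _ _).2 hbI

theorem hp_normSq (K : Type*) [Field K] [CharZero K] (φ : K →+* ℂ) (m : ℤ) (hm : m < 0)
    (sqm : K) (hsq : sqm ^ 2 = (m : K)) (x y : ℚ) :
    Complex.normSq (φ ((x : K) + y * sqm)) = (x : ℝ) ^ 2 - m * (y : ℝ) ^ 2 := by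
  have h : (φ sqm) ^ 2 = (m : ℂ) := by rw [← map_pow, hsq, map_intCast]
  have hm' : (m : ℝ) < 0 := by exact_mod_cast hm
  have hre := congrArg Complex.re h
  have him := congrArg Complex.im h
  simp only [pow_two, Complex.mul_re, Complex.mul_im, Complex.intCast_re,
    Complex.intCast_im] at hre him
  have h0 : (φ sqm).re = 0 := by
    have : (φ sqm).re * (φ sqm).im = 0 := by linarith
    rcases mul_eq_zero.1 this with h | h
    · exact h
    · rw [h] at hre
      nlinarith [mul_self_nonneg (φ sqm).re]
  rw [h0] at hre
  rw [map_add, map_mul, map_ratCast, map_ratCast, Complex.normSq_apply]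
  simp only [Complex.add_re, Complex.add_im, Complex.mul_re, Complex.mul_im, Complex.ratCast_re,
    Complex.ratCast_im, h0]
  linear_combination (-(y : ℝ) ^ 2) * hre

theorem hp_repr (K : Type*) [Field K] [NumberField K] (m : ℤ)
    (sqm : K) (hsq : sqm ^ 2 = (m : K)) (hgen : Algebra.adjoin ℚ {sqm} = ⊤) (z : K) :
    ∃ x y : ℚ, z = (x : K) + y * sqm := by
  have hz : z ∈ Algebra.adjoin ℚ {sqm} := by rw [hgen]; trivial
  induction hz using Algebra.adjoin_induction with
  | mem x hx => 
    rw [Set.mem_singleton_iff] at hx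
    exact ⟨0, 1, by simp [hx]⟩
  | algebraMap r => exact ⟨r, 0, by simp⟩
  | add a b _ _ ha hb =>
    obtain ⟨x, y, rfl⟩ := ha
    obtain ⟨u, v, rfl⟩ := hb
    exact ⟨x + u, y + v, by push_cast; ring⟩
  | mul a b _ _ ha hb =>
    obtain ⟨x, y, rfl⟩ := ha
    obtain ⟨u, v, rfl⟩ := hb
    exact ⟨x * u + m * y * v, x * v + y * u, by
      push_cast; linear_combination ((y : K) * v) * hsq⟩

theorem hp_int (K : Type*) [Field K] [NumberField K] (φ : K →+* ℂ) (m : ℤ) (hm : m < 0)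
    (sqm : K) (hsq : sqm ^ 2 = (m : K)) (hgen : Algebra.adjoin ℚ {sqm} = ⊤)
    (z : K) (hz : IsIntegral ℤ z) : ∃ n : ℕ, Complex.normSq (φ z) = n := by
  obtain ⟨x, y, hxy⟩ := hp_repr K m sqm hsq hgen z
  have hn := hp_normSq K φ m hm sqm hsq x y
  rw [← hxy] at hn
  have h1 : IsIntegral ℤ (φ z) := hz.map φ.toIntAlgHom
  have h2 : IsIntegral ℤ ((starRingEnd ℂ) (φ z)) := h1.map (starRingEnd ℂ).toIntAlgHom
  have h3 := h1.mul h2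
  rw [Complex.mul_conj, hn] at h3
  have h4 : IsIntegral ℤ (algebraMap ℚ ℂ (x ^ 2 - m * y ^ 2)) := by
    have e : algebraMap ℚ ℂ (x ^ 2 - m * y ^ 2) =
        (((x : ℝ) ^ 2 - m * (y : ℝ) ^ 2 : ℝ) : ℂ) := by
      rw [eq_ratCast]; push_cast; rfl
    rw [e]; exact h3
  have h5 := (isIntegral_algebraMap_iff (algebraMap ℚ ℂ).injective).1 h4
  obtain ⟨k, hk⟩ := IsIntegrallyClosed.isIntegral_iff.1 h5
  have hk' : ((k : ℤ) : ℝ) = Complex.normSq (φ z) := by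
    rw [hn]
    have := congrArg (fun q : ℚ => (q : ℝ)) hk
    simpa using this
  have hk0 : 0 ≤ k := by
    have := Complex.normSq_nonneg (φ z)
    rw [← hk'] at this
    exact_mod_cast this
  lift k to ℕ using hk0
  exact ⟨k, by rw [← hk']; simp⟩

theorem hp_small (K : Type*) [Field K] [NumberField K] (m : ℤ) (hm : m < 0) (hm2 : -3 < m)
    (sqm : K) (hsq : sqm ^ 2 = (m : K)) (hgen : Algebra.adjoin ℚ {sqm} = ⊤) :
    IsPrincipalIdealRing (NumberField.RingOfIntegers K) := by
  obtain ⟨φ⟩ : Nonempty (K →+* ℂ) := inferInstance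
  refine hp_pid_of_dh K φ (hp_int K φ m hm sqm hsq hgen) fun α hα => ?_
  have hs : IsIntegral ℤ sqm := by
    apply IsIntegral.of_pow (n := 2) (by norm_num)
    rw [hsq]; exact isIntegral_algebraMap (R := ℤ) (x := m)
  have hI : ∀ k : ℤ, IsIntegral ℤ (k : K) := fun k => isIntegral_algebraMap (R := ℤ) (x := k)
  obtain ⟨x, y, rfl⟩ := hp_repr K m sqm hsq hgen α
  have ht : IsIntegral ℤ ((round x : ℤ) + (round y : ℤ) * sqm : K) :=
    (hI _).add ((hI _).mul hs)
  refine ⟨1, _, isIntegral_one, ht, ?_, ?_⟩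
  · rw [Complex.normSq_pos, map_ne_zero]
    intro h
    apply hα
    have : (x : K) + y * sqm = (round x : ℤ) + (round y : ℤ) * sqm := by linear_combination h
    rw [this]; exact ht
  · have e : (1 * ((x : K) + y * sqm) - ((round x : ℤ) + (round y : ℤ) * sqm) : K) =
      ((x - round x : ℚ) : K) + ((y - round y : ℚ) : K) * sqm := by push_cast; ring
    rw [e, hp_normSq K φ m hm sqm hsq]
    have a := abs_le.1 (abs_sub_round x)
    have b := abs_le.1 (abs_sub_round y)
    have a2 : (x - round x) ^ 2 ≤ 1 / 4 := by nlinarith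
    have b2 : (y - round y) ^ 2 ≤ 1 / 4 := by nlinarith
    have hmq : (-2 : ℚ) ≤ m := by exact_mod_cast (by omega : -2 ≤ m)
    have : (x - round x) ^ 2 - m * (y - round y) ^ 2 < 1 := by
      nlinarith [sq_nonneg (y - round y)]
    exact_mod_cast this

theorem hp_big (K : Type*) [Field K] [NumberField K] (m q : ℤ) (hmq : m = 1 - 4 * q) (hm : m < 0)
    (N : ℕ) (hN : 0 < N) (hb : -m < 3 * ((N : ℤ) + 1) ^ 2)
    (hin : ∀ p : ℕ, p.Prime → p ≤ N → ∀ x y : ℤ, (p : ℤ) ∣ x ^ 2 + x * y + q * y ^ 2 →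
      (p : ℤ) ∣ x ∧ (p : ℤ) ∣ y)
    (sqm : K) (hsq : sqm ^ 2 = (m : K)) (hgen : Algebra.adjoin ℚ {sqm} = ⊤) :
    IsPrincipalIdealRing (NumberField.RingOfIntegers K) := by
  obtain ⟨φ⟩ : Nonempty (K →+* ℂ) := inferInstance
  refine hp_pid_of_dh K φ (hp_int K φ m hm sqm hsq hgen) fun α hα => ?_
  have hI : ∀ k : ℤ, IsIntegral ℤ (k : K) := fun k => isIntegral_algebraMap (R := ℤ) (x := k)
  obtain ⟨w, hw⟩ : ∃ w : K, w = (1 + sqm) / 2 := ⟨_, rfl⟩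
  have hmK : (m : K) = 1 - 4 * q := by rw [hmq]; push_cast; ring
  have hw2 : w ^ 2 = w - q := by
    rw [hw]
    linear_combination (1 / 4 : K) * hsq + (1 / 4 : K) * hmK
  have hwI : IsIntegral ℤ w := by
    refine ⟨Polynomial.X ^ 2 - Polynomial.X + Polynomial.C q, by monicity!, ?_⟩
    rw [Polynomial.eval₂_add, Polynomial.eval₂_sub, Polynomial.eval₂_pow, Polynomial.eval₂_X,
      Polynomial.eval₂_C, hw2, eq_intCast]
    ring
  have hwn : ∀ x y : ℚ, Complex.normSq (φ ((x : K) + y * w)) =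
      (((x + y / 2) ^ 2 - m * (y / 2) ^ 2 : ℚ) : ℝ) := by
    intro x y
    have : (x : K) + y * w = ((x + y / 2 : ℚ) : K) + ((y / 2 : ℚ) : K) * sqm := by
      rw [hw]; push_cast; ring
    rw [this, hp_normSq K φ m hm sqm hsq]
    push_cast; ring
  -- torsion case
  have key : ∀ n : ℕ, 0 < n → n ≤ N → ∀ x y : ℤ, (n : K) * α = x + y * w →
      ∃ s t : K, IsIntegral ℤ s ∧ IsIntegral ℤ t ∧
      0 < Complex.normSq (φ (s * α - t)) ∧ Complex.normSq (φ (s * α - t)) < 1 := by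
    intro n
    induction n using Nat.strong_induction_on with
    | _ n ih =>
    intro hn0 hnN x y hxy
    by_cases hn1 : n = 1
    · exfalso
      apply hα
      rw [hn1] at hxy
      have : α = x + y * w := by simpa using hxy
      rw [this]
      exact (hI _).add ((hI _).mul hwI)
    obtain ⟨p, hp, k, hk⟩ := Nat.exists_prime_and_dvd hn1
    have hk0 : 0 < k := by
      rcases Nat.eq_zero_or_pos k with h | h
      · subst h; omega
      · exact h
    have hpn : p ≤ n := Nat.le_of_dvd hn0 ⟨k, hk⟩
    have hkn : k < n := by rw [hk]; nlinarith [hp.two_le]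
    have hpK : (p : K) ≠ 0 := by exact_mod_cast hp.ne_zero
    have hpQ : (p : ℚ) ≠ 0 := by exact_mod_cast hp.ne_zero
    have hnK : (n : K) = p * k := by rw [hk]; push_cast; ring
    by_cases hd : (p : ℤ) ∣ x ^ 2 + x * y + q * y ^ 2
    · obtain ⟨⟨u, hu⟩, ⟨v, hv⟩⟩ := hin p hp (hpn.trans hnN) x y hd
      refine ih k hkn hk0 (hkn.le.trans hnN) u v ?_
      apply mul_left_cancel₀ hpK
      rw [hnK, hu, hv] at hxy
      push_cast at hxy
      linear_combination hxy
    · set M : ℤ := x ^ 2 + x * y + q * y ^ 2 with hM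
      set r : ℚ := (M : ℚ) / p with hr
      have hsα : ((k : ℤ) : K) * (x + y * (1 - w)) * α = (r : K) := by
        apply mul_left_cancel₀ hpK
        rw [hr]
        push_cast
        rw [mul_div_cancel₀ _ hpK, hM]
        push_cast
        rw [hnK] at hxy
        linear_combination ((x : K) + y * (1 - w)) * hxy - (y : K) ^ 2 * hw2
      refine ⟨((k : ℤ) : K) * (x + y * (1 - w)), ((round r : ℤ) : K),
        (hI _).mul ((hI _).add ((hI _).mul (isIntegral_one.sub hwI))), hI _, ?_, ?_⟩
      · rw [hsα, Complex.normSq_pos, map_ne_zero]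
        intro h
        apply hd
        have h' : r = ((round r : ℤ) : ℚ) := by
          have h2 : ((r : ℚ) : K) = (((round r : ℤ) : ℚ) : K) := by
            push_cast; linear_combination h
          exact_mod_cast h2
        refine ⟨round r, ?_⟩
        have : (M : ℚ) = p * (round r : ℤ) := by
          rw [← h', hr]; field_simp
        exact_mod_cast this
      · have e : ((r : K) - ((round r : ℤ) : K)) =
            ((r - round r : ℚ) : K) + ((0 : ℚ) : K) * w := by push_cast; ring
        rw [hsα, e, hwn]
        have a := abs_le.1 (abs_sub_round r)
        have a2 : (r - round r + 0 / 2) ^ 2 - m * (0 / 2) ^ 2 < (1 : ℚ) := by nlinarith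
        exact_mod_cast a2
  obtain ⟨a, b, hab⟩ : ∃ a b : ℚ, α = a + b * w := by
    obtain ⟨x, y, hxy⟩ := hp_repr K m sqm hsq hgen α
    exact ⟨x - y, 2 * y, by rw [hxy, hw]; push_cast; ring⟩
  obtain ⟨j, k, hk0, hkN, hjk⟩ := Real.exists_int_int_abs_mul_sub_le (b : ℝ) hN
  have hjk' : |(k : ℚ) * b - j| ≤ 1 / ((N : ℚ) + 1) := by
    have : ((|(k : ℚ) * b - j| : ℚ) : ℝ) ≤ ((1 / ((N : ℚ) + 1) : ℚ) : ℝ) := by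
      push_cast; exact hjk
    exact Rat.cast_le.1 this
  set ε : ℚ := k * b - j with hε
  set i : ℤ := round ((k : ℚ) * a + ε / 2) with hi
  by_cases h0 : (k : K) * α - (i + j * w) = 0
  · lift k to ℕ using hk0.le
    refine key k (by exact_mod_cast hk0) (by exact_mod_cast hkN) i j ?_
    rw [Int.cast_natCast] at h0
    linear_combination h0
  · refine ⟨k, i + j * w, hI _, (hI _).add ((hI _).mul hwI), ?_, ?_⟩
    · rw [Complex.normSq_pos, map_ne_zero]
      exact h0
    · have e : (k : K) * α - (i + j * w) = ((k * a - i : ℚ) : K) + (ε : K) * w := by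
        rw [hab, hε]; push_cast; ring
      rw [e, hwn]
      have a1 := abs_le.1 (abs_sub_round ((k : ℚ) * a + ε / 2))
      rw [← hi] at a1
      have a2 : ((k : ℚ) * a - i + ε / 2) ^ 2 ≤ 1 / 4 := by nlinarith
      have hN1 : (0 : ℚ) < (N : ℚ) + 1 := by positivity
      have hε2 : ε ^ 2 * ((N : ℚ) + 1) ^ 2 ≤ 1 := by
        rw [le_div_iff₀ hN1] at hjk'
        rw [← mul_pow, ← sq_abs, abs_mul, abs_of_pos hN1]
        exact pow_le_one₀ (by positivity) hjk'
      have hbQ : (-m : ℚ) < 3 * ((N : ℚ) + 1) ^ 2 := by exact_mod_cast hb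
      have hmQ : (m : ℚ) < 0 := by exact_mod_cast hm
      have b2 : -m * ε ^ 2 < (3 : ℚ) := by
        rcases eq_or_ne ε 0 with h | h
        · rw [h]; norm_num
        · have : 0 < ε ^ 2 := by positivity
          nlinarith
      have : ((k : ℚ) * a - i + ε / 2) ^ 2 - m * (ε / 2) ^ 2 < 1 := by nlinarith
      exact_mod_cast this

theorem hp_inert (p : ℕ) (q : ℤ)
    (h : ∀ x y : ZMod p, x ^ 2 + x * y + (q : ZMod p) * y ^ 2 = 0 → x = 0 ∧ y = 0)
    (x y : ℤ) (hd : (p : ℤ) ∣ x ^ 2 + x * y + q * y ^ 2) : (p : ℤ) ∣ x ∧ (p : ℤ) ∣ y := by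
  simp only [← ZMod.intCast_zmod_eq_zero_iff_dvd] at *
  push_cast at hd
  exact h _ _ hd

/-- The ring of integers of ℚ(√m) is a PID for the nine Heegner values. -/
theorem heegner_pid (m : ℤ)
    (hm : m = -1 ∨ m = -2 ∨ m = -3 ∨ m = -7 ∨ m = -11 ∨ m = -19 ∨ m = -43 ∨
          m = -67 ∨ m = -163)
    (K : Type*) [Field K] [NumberField K] (sqm : K) (hsq : sqm ^ 2 = (m : K))
    (hgen : Algebra.adjoin ℚ {sqm} = ⊤) :
    IsPrincipalIdealRing (NumberField.RingOfIntegers K) := by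
  have triv : ∀ q : ℤ, ∀ p : ℕ, p.Prime → p ≤ 1 → ∀ x y : ℤ,
      (p : ℤ) ∣ x ^ 2 + x * y + q * y ^ 2 → (p : ℤ) ∣ x ∧ (p : ℤ) ∣ y :=
    fun q p hp h => absurd hp.two_le (by omega)
  rcases hm with h | h | h | h | h | h | h | h | h
  · exact hp_small K m (by omega) (by omega) sqm hsq hgen
  · exact hp_small K m (by omega) (by omega) sqm hsq hgen
  · exact hp_big K m 1 (by omega) (by omega) 1 (by omega) (by rw [h]; norm_num) (triv _)
      sqm hsq hgen
  · exact hp_big K m 2 (by omega) (by omega) 1 (by omega) (by rw [h]; norm_num) (triv _)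
      sqm hsq hgen
  · exact hp_big K m 3 (by omega) (by omega) 1 (by omega) (by rw [h]; norm_num) (triv _)
      sqm hsq hgen
  · refine hp_big K m 5 (by omega) (by omega) 2 (by omega) (by rw [h]; norm_num) ?_ sqm hsq hgen
    intro p hp hpN
    apply hp_inert
    interval_cases p <;> first | decide | (exfalso; revert hp; norm_num)
  · refine hp_big K m 11 (by omega) (by omega) 3 (by omega) (by rw [h]; norm_num) ?_ sqm hsq hgen
    intro p hp hpN
    apply hp_inert
    interval_cases p <;> first | decide | (exfalso; revert hp; norm_num)
  · refine hp_big K m 17 (by omega) (by omega) 4 (by omega) (by rw [h]; norm_num) ?_ sqm hsq hgen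
    intro p hp hpN
    apply hp_inert
    interval_cases p <;> first | decide | (exfalso; revert hp; norm_num)
  · refine hp_big K m 41 (by omega) (by omega) 7 (by omega) (by rw [h]; norm_num) ?_ sqm hsq hgen
    intro p hp hpN
    apply hp_inert
    interval_cases p <;> first | decide | (exfalso; revert hp; norm_num)
end

section
/- Let m < 0 be squarefree with discriminant Δ (Δ = m if m ≡ 1 mod 4, Δ = 4m otherwise). If the Legendre/Kronecker symbol (Δ/p) = −1 for every prime p with 2 ≤ p ≤ √(−Δ/3), then the ring of integers of ℚ(√m) is a principal ideal domain. -/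
open NumberField in
theorem core_aux {K : Type*} [Field K] [NumberField K] (w : 𝓞 K) (t N Δ : ℤ)
    (hw : (w : K) ^ 2 = t * w - N) (hΔ : t ^ 2 - 4 * N = Δ) (hneg : Δ < 0)
    (hspan : ∀ x : K, ∃ u v : ℚ, x = u + v * w)
    (hnorm : ∀ u v : ℚ, Algebra.norm ℚ ((u : K) + v * w) = u ^ 2 + t * u * v + N * v ^ 2)
    (h : ∀ p : ℕ, p.Prime → 3 * (p : ℚ) ^ 2 ≤ -Δ →
      if p = 2 then Δ % 8 = 5 else jacobiSym Δ p = -1) :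
    IsPrincipalIdealRing (𝓞 K) := by
  have hΔq : (t : ℚ) ^ 2 - 4 * N = Δ := by exact_mod_cast hΔ
  have hnegq : (Δ : ℚ) < 0 := by exact_mod_cast hneg
  have hnn : ∀ x : K, 0 ≤ Algebra.norm ℚ x := by
    intro x
    obtain ⟨u, v, rfl⟩ := hspan x
    rw [hnorm]
    nlinarith [sq_nonneg (2 * u + t * v), mul_nonneg (neg_nonneg.2 hnegq.le) (sq_nonneg v)]
  constructor
  intro I
  by_cases hI : I = ⊥
  · subst hI; exact bot_isPrincipal
  obtain ⟨a0, ha0, ha0'⟩ := Submodule.exists_mem_ne_zero_of_ne_bot hI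
  obtain ⟨α, ⟨hαI, hα0⟩, hαmin⟩ := WellFounded.has_min
    (InvImage.wf (fun x : 𝓞 K => (Algebra.norm ℤ x).natAbs) Nat.lt_wfRel.wf)
    {x : 𝓞 K | x ∈ I ∧ x ≠ 0} ⟨a0, ha0, ha0'⟩
  have hmin : ∀ y ∈ I, y ≠ 0 → Algebra.norm ℚ (α : K) ≤ Algebra.norm ℚ (y : K) := by
    intro y hy hy0
    have h1 : ¬ ((Algebra.norm ℤ y).natAbs < (Algebra.norm ℤ α).natAbs) := hαmin y ⟨hy, hy0⟩
    have h2 := hnn (α : K)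
    have h3 := hnn (y : K)
    rw [← Algebra.coe_norm_int] at h2 h3 ⊢
    rw [← Algebra.coe_norm_int]
    have h2' : 0 ≤ Algebra.norm ℤ α := by exact_mod_cast h2
    have h3' : 0 ≤ Algebra.norm ℤ y := by exact_mod_cast h3
    have : Algebra.norm ℤ α ≤ Algebra.norm ℤ y := by omega
    exact_mod_cast this
  have hαK : (α : K) ≠ 0 := by simpa using hα0
  have hαpos : 0 < Algebra.norm ℚ (α : K) :=
    lt_of_le_of_ne (hnn _) (Ne.symm (by simpa [Algebra.norm_eq_zero_iff] using hα0))
  let J : K → Prop := fun x => ∃ y ∈ I, (y : K) = x * α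
  have Jsub : ∀ x y, J x → J y → J (x - y) := by
    rintro x y ⟨a, ha, ha'⟩ ⟨b, hb, hb'⟩
    exact ⟨a - b, I.sub_mem ha hb, by
      have e1 : algebraMap (𝓞 K) K a = x * algebraMap (𝓞 K) K α := ha'
      have e2 : algebraMap (𝓞 K) K b = y * algebraMap (𝓞 K) K α := hb'
      change algebraMap (𝓞 K) K (a - b) = (x - y) * algebraMap (𝓞 K) K α
      rw [map_sub, e1, e2]; ring⟩
  have Jmul : ∀ (c : 𝓞 K) x, J x → J (c * x) := by
    rintro c x ⟨a, ha, ha'⟩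
    exact ⟨c * a, I.mul_mem_left c ha, by
      have e1 : algebraMap (𝓞 K) K a = x * algebraMap (𝓞 K) K α := ha'
      change algebraMap (𝓞 K) K (c * a) = algebraMap (𝓞 K) K c * x * algebraMap (𝓞 K) K α
      rw [map_mul, e1]; ring⟩
  have Jint : ∀ (c : ℤ) x, J x → J (c * x) := by
    intro c x hx
    have := Jmul (c : 𝓞 K) x hx
    simpa using this
  have J1 : J 1 := ⟨α, hαI, by simp⟩
  have Jc : ∀ c : ℤ, J (c : K) := fun c => by simpa using Jint c 1 J1
  have Jw : J (w : K) := by simpa using Jmul w 1 J1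
  have Jnorm : ∀ x, J x → x ≠ 0 → 1 ≤ Algebra.norm ℚ x := by
    rintro x ⟨y, hy, hy'⟩ hx
    have hy0 : y ≠ 0 := by
      rintro rfl
      have : x * (α : K) = 0 := by rw [← hy']; simp
      exact (mul_ne_zero hx hαK) this
    have := hmin y hy hy0
    rw [hy', map_mul] at this
    by_contra hlt
    push Not at hlt
    nlinarith
  have Jrat : ∀ r : ℚ, J (r : K) → ∃ z : ℤ, r = z := by
    intro r hr
    refine ⟨round r, ?_⟩
    by_contra hne
    have h1 := Jsub _ _ hr (Jc (round r))
    have h2 : ((r : K) - (round r : ℤ)) ≠ 0 := by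
      intro h0
      apply hne
      have : (r : K) = ((round r : ℤ) : ℚ) := by push_cast; linear_combination h0
      exact_mod_cast this
    have h3 := Jnorm _ h1 h2
    have h4 := hnorm (r - round r) 0
    have h5 : (((r - round r : ℚ) : K) + ((0 : ℚ) : K) * w) = (r : K) - (round r : ℤ) := by
      push_cast; ring
    rw [h5] at h4
    rw [h4] at h3
    have h6 := abs_le.1 (abs_sub_round r)
    nlinarith [h6.1, h6.2]
  -- key: the second coordinate is integral
  have Jkey : ∀ u v : ℚ, J ((u : K) + v * w) → v.den = 1 := by
    intro u v hx
    by_contra hden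
    obtain ⟨s, hs⟩ : ∃ s : ℕ, s = v.den := ⟨_, rfl⟩
    have hspos : 0 < s := hs ▸ v.den_pos
    have hsQ : (0 : ℚ) < s := by exact_mod_cast hspos
    have hsne : (s : ℚ) ≠ 0 := hsQ.ne'
    have hsK : (s : K) ≠ 0 := by exact_mod_cast hspos.ne'
    have hcop : IsCoprime v.num (s : ℤ) := by
      rw [Int.isCoprime_iff_gcd_eq_one, hs]
      simpa [Int.gcd] using v.reduced
    obtain ⟨k, j, hkj⟩ := hcop
    have hv : v = v.num / s := by rw [hs]; exact (Rat.num_div_den v).symm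
    have hkjq : (k : ℚ) * v.num + j * s = 1 := by exact_mod_cast hkj
    have hkv : (k : ℚ) * v + j = 1 / s := by
      rw [eq_div_iff hsne]
      have : v * s = v.num := by
        nth_rewrite 1 [hv]; field_simp
      linear_combination hkjq + k * this
    have hτ0 : J (((k * u : ℚ) : K) + ((1 / s : ℚ) : K) * w) := by
      have h1 := Jsub _ _ (Jint k _ hx) (Jint (-j) _ Jw)
      rw [← hkv]
      convert h1 using 1
      push_cast; ring
    -- shift
    set c : ℤ := round (k * u + t / (2 * s) : ℚ) with hc
    set u' : ℚ := k * u - c with hu'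
    have hτ : J ((u' : K) + ((1 / s : ℚ) : K) * w) := by
      have h1 := Jsub _ _ hτ0 (Jc c)
      convert h1 using 1
      rw [hu']; push_cast; ring
    have hb := abs_le.1 (abs_sub_round (k * u + t / (2 * s) : ℚ))
    rw [← hc] at hb
    have hτne : ((u' : K) + ((1 / s : ℚ) : K) * w) ≠ 0 := by
      intro h0
      have h1 := hnorm u' (1 / s)
      rw [h0, Algebra.norm_zero] at h1
      have : 0 < 1 / (s : ℚ) := by positivity
      nlinarith [sq_nonneg (2 * u' + t * (1 / s)), mul_pos (neg_pos.2 hnegq) (pow_pos this 2)]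
    have hn := Jnorm _ hτ hτne
    rw [hnorm] at hn
    have hsize : 3 * (s : ℚ) ^ 2 ≤ -Δ := by
      have e : (t : ℚ) / (2 * s) = t * (1 / s) / 2 := by field_simp
      rw [e] at hb
      set y : ℚ := 1 / s with hy
      have hys : y * s = 1 := by rw [hy]; field_simp
      have h1 : (u' + t * y / 2) ^ 2 ≤ 1 / 4 := by
        have h2 : u' + t * y / 2 = k * u + t * y / 2 - c := by rw [hu']; ring
        rw [h2]
        nlinarith [hb.1, hb.2]
      have h3 : 3 ≤ -Δ * y ^ 2 := by
        rw [← hΔq]; nlinarith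
      have h4 : -(Δ : ℚ) = -Δ * y ^ 2 * s ^ 2 := by
        linear_combination (Δ : ℚ) * (y * s + 1) * hys
      rw [h4]
      gcongr
    -- integrality of s * u'
    obtain ⟨b, hb'⟩ := Jrat (s * u') (by
      have h1 := Jsub _ _ (Jint s _ hτ) Jw
      convert h1 using 1
      push_cast
      field_simp
      ring)
    obtain ⟨d, hd⟩ := Jrat ((-N - b * (t + b)) / s) (by
      have h1 := Jsub _ _ (Jmul w _ hτ) (Jint (t + b) _ hτ)
      convert h1 using 1
      have hu2 : (u' : K) = b / s := by
        rw [eq_div_iff hsK]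
        have : ((s * u' : ℚ) : K) = ((b : ℚ) : K) := by rw [hb']
        push_cast at this
        linear_combination this
      rw [hu2]
      push_cast
      field_simp
      linear_combination -hw)
    have hdvd : (s : ℤ) ∣ b ^ 2 + t * b + N := by
      refine ⟨-d, ?_⟩
      rw [div_eq_iff hsne] at hd
      have : -N - b * (t + b) = d * (s : ℤ) := by exact_mod_cast hd
      linear_combination -this
    obtain ⟨p, hp, hps⟩ := Nat.exists_prime_and_dvd (n := s) (by rw [hs]; exact hden)
    have hple : (p : ℚ) ≤ s := by exact_mod_cast Nat.le_of_dvd hspos hps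
    have hpd : (p : ℤ) ∣ b ^ 2 + t * b + N := (Int.natCast_dvd_natCast.2 hps).trans hdvd
    have hp' := h p hp (le_trans (by gcongr) hsize)
    split_ifs at hp' with h2
    · subst h2
      have ht : t % 2 = 1 := by
        rcases Int.emod_two_eq_zero_or_one t with ht | ht
        · obtain ⟨r, rfl⟩ : (2 : ℤ) ∣ t := Int.dvd_of_emod_eq_zero ht
          have : Δ = 4 * (r ^ 2 - N) := by rw [← hΔ]; ring
          omega
        · exact ht
      have ht8 : t ^ 2 % 8 = 1 := by
        have h8 : t % 8 = 1 ∨ t % 8 = 3 ∨ t % 8 = 5 ∨ t % 8 = 7 := by omega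
        rcases h8 with h8 | h8 | h8 | h8 <;> simp [pow_two, Int.mul_emod, h8]
      have hN : N % 2 = 1 := by omega
      have hbb : (b ^ 2 + t * b) % 2 = 0 := by
        rcases Int.emod_two_eq_zero_or_one b with hb2 | hb2 <;>
          simp [pow_two, Int.add_emod, Int.mul_emod, ht, hb2]
      push_cast at hpd
      omega
    · have : Fact p.Prime := ⟨hp⟩
      apply ZMod.nonsquare_of_jacobiSym_eq_neg_one hp'
      refine ⟨((2 * b + t : ℤ) : ZMod p), ?_⟩
      have h0 := (ZMod.intCast_zmod_eq_zero_iff_dvd _ p).2 hpd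
      rw [← hΔ]
      push_cast at h0 ⊢
      linear_combination -4 * h0
  refine ⟨α, le_antisymm ?_ ?_⟩
  · intro y hy
    obtain ⟨u, v, huv⟩ := hspan ((y : K) / α)
    have hJ : J ((u : K) + v * w) := ⟨y, hy, by rw [← huv]; field_simp⟩
    have hv1 := Jkey u v hJ
    have hv : v = v.num := by
      nth_rewrite 1 [← Rat.num_div_den v]; rw [hv1]; simp
    have hvK : (v : K) = (v.num : K) := by
      nth_rewrite 1 [hv]; simp
    obtain ⟨z, hz⟩ := Jrat u (by
      have h1 := Jsub _ _ hJ (Jint v.num _ Jw)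
      convert h1 using 1
      rw [hvK]; ring)
    rw [Submodule.mem_span_singleton]
    refine ⟨(z : 𝓞 K) + (v.num : 𝓞 K) * w, ?_⟩
    apply RingOfIntegers.ext
    have huK : (u : K) = (z : K) := by rw [hz]; simp
    rw [smul_eq_mul]
    push_cast
    rw [div_eq_iff hαK, huK, hvK] at huv
    simpa using huv.symm
  · rw [Submodule.span_singleton_le_iff_mem]; exact hαI

theorem quad_norm_aux {K : Type*} [Field K] [NumberField K] (m : ℤ) (hmneg : m < 0)
    (sqm : K) (hsq : sqm ^ 2 = (m : K)) (hgen : Algebra.adjoin ℚ {sqm} = ⊤) :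
    (∀ x : K, ∃ u v : ℚ, x = u + v * sqm) ∧
    ∀ u v : ℚ, Algebra.norm ℚ ((u : K) + v * sqm) = u ^ 2 - m * v ^ 2 := by
  have hspan : ∀ x : K, ∃ u v : ℚ, x = u + v * sqm := by
    intro x
    have hx : x ∈ Algebra.adjoin ℚ {sqm} := by rw [hgen]; trivial
    induction hx using Algebra.adjoin_induction with
    | mem x hx => exact ⟨0, 1, by simp at hx; simp [hx]⟩
    | algebraMap r => exact ⟨r, 0, by simp⟩
    | add x y _ _ hx hy =>
      obtain ⟨a, b, rfl⟩ := hx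
      obtain ⟨c, d, rfl⟩ := hy
      exact ⟨a + c, b + d, by push_cast; ring⟩
    | mul x y _ _ hx hy =>
      obtain ⟨a, b, rfl⟩ := hx
      obtain ⟨c, d, rfl⟩ := hy
      exact ⟨a * c + m * b * d, a * d + b * c, by
        push_cast; linear_combination (b : K) * d * hsq⟩
  refine ⟨hspan, ?_⟩
  have hmq : (m : ℚ) < 0 := by exact_mod_cast hmneg
  have hli : LinearIndependent ℚ ![(1 : K), sqm] := by
    rw [LinearIndependent.pair_iff]
    intro s t hst
    simp only [Rat.smul_def, mul_one] at hst
    have h1 : ((s ^ 2 : ℚ) : K) = ((m * t ^ 2 : ℚ) : K) := by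
      push_cast
      linear_combination ((s : K) - t * sqm) * hst + (t : K) ^ 2 * hsq
    have h2 : s ^ 2 = m * t ^ 2 := by exact_mod_cast h1
    have ht : t = 0 := by
      by_contra ht
      have : 0 < t ^ 2 := by positivity
      nlinarith [sq_nonneg s]
    subst ht
    simpa using h2
  have hsp : ⊤ ≤ Submodule.span ℚ (Set.range ![(1 : K), sqm]) := by
    intro x _
    obtain ⟨u, v, rfl⟩ := hspan x
    rw [Matrix.range_cons, Matrix.range_cons, Matrix.range_empty, Set.union_empty,
      Set.singleton_union, Submodule.mem_span_pair]
    exact ⟨u, v, by simp [Rat.smul_def]⟩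
  let B := Module.Basis.mk hli hsp
  have hB0 : B 0 = 1 := by simp [B]
  have hB1 : B 1 = sqm := by simp [B]
  intro u v
  have hM : Algebra.leftMulMatrix B ((u : K) + v * sqm) = !![u, m * v; v, u] := by
    have e0 : ((u : K) + v * sqm) * B 0 = u • B 0 + v • B 1 := by
      rw [hB0, hB1]; simp [Rat.smul_def]
    have e1 : ((u : K) + v * sqm) * B 1 = (m * v : ℚ) • B 0 + u • B 1 := by
      rw [hB0, hB1]; simp only [Rat.smul_def]; push_cast; linear_combination (v : K) * hsq
    ext i j
    rw [Algebra.leftMulMatrix_eq_repr_mul]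
    fin_cases j
    · simp only [Fin.zero_eta, e0]; fin_cases i <;> simp
    · simp only [Fin.mk_one, e1]; fin_cases i <;> simp
  rw [Algebra.norm_eq_matrix_det B, hM, Matrix.det_fin_two_of]
  ring

/-- If (Δ/p) = −1 for every prime p ≤ √(−Δ/3), then the ring of integers of the
imaginary quadratic field ℚ(√m) is a PID.  For odd p the symbol is the Legendre
(= Jacobi) symbol; for p = 2 the Kronecker symbol (Δ/2) = −1 means Δ ≡ 5 (mod 8). -/
theorem inert_small_primes_pid (m : ℤ) (hm : Squarefree m) (hmneg : m < 0)
    (Δ : ℤ) (hΔ : Δ = if m % 4 = 1 then m else 4 * m)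
    (h : ∀ p : ℕ, p.Prime → (p : ℝ) ≤ Real.sqrt (-(Δ : ℝ) / 3) →
      if p = 2 then Δ % 8 = 5 else jacobiSym Δ p = -1)
    (K : Type*) [Field K] [NumberField K] (sqm : K) (hsq : sqm ^ 2 = (m : K))
    (hgen : Algebra.adjoin ℚ {sqm} = ⊤) :
    IsPrincipalIdealRing (NumberField.RingOfIntegers K) := by
  obtain ⟨hspan, hnorm⟩ := quad_norm_aux m hmneg sqm hsq hgen
  have h' : ∀ p : ℕ, p.Prime → 3 * (p : ℚ) ^ 2 ≤ -Δ →
      if p = 2 then Δ % 8 = 5 else jacobiSym Δ p = -1 := by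
    intro p hp hle
    apply h p hp
    apply Real.le_sqrt_of_sq_le
    have : 3 * (p : ℝ) ^ 2 ≤ -Δ := by exact_mod_cast hle
    linarith
  split_ifs at hΔ with h4
  · obtain ⟨N, hN⟩ : ∃ N : ℤ, 1 - m = 4 * N := ⟨(1 - m) / 4, by omega⟩
    have hNK : (1 : K) - m = 4 * N := by exact_mod_cast congrArg (Int.cast : ℤ → K) hN
    have hNQ : (1 : ℚ) - m = 4 * N := by exact_mod_cast hN
    have hw : ((1 + sqm) / 2) ^ 2 = ((1 : ℤ) : K) * ((1 + sqm) / 2) - N := by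
      push_cast
      linear_combination hsq / 4 - hNK / 4
    have hint : IsIntegral ℤ ((1 + sqm) / 2) := by
      refine ⟨Polynomial.X ^ 2 - Polynomial.X + Polynomial.C N, by monicity!, ?_⟩
      simp only [Polynomial.eval₂_add, Polynomial.eval₂_sub, Polynomial.eval₂_pow,
        Polynomial.eval₂_X, Polynomial.eval₂_C]
      rw [eq_intCast]
      linear_combination hw
    refine core_aux (⟨(1 + sqm) / 2, hint⟩ : NumberField.RingOfIntegers K) 1 N Δ hw
      (by rw [hΔ]; linarith) (by omega) ?_ ?_ h'
    · intro x
      obtain ⟨u, v, rfl⟩ := hspan x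
      refine ⟨u - v, 2 * v, ?_⟩
      change _ = _ + _ * ((1 + sqm) / 2)
      push_cast; ring
    · intro u v
      change Algebra.norm ℚ ((u : K) + v * ((1 + sqm) / 2)) = _
      have := hnorm (u + v / 2) (v / 2)
      rw [show (u : K) + v * ((1 + sqm) / 2) = ((u + v / 2 : ℚ) : K) + ((v / 2 : ℚ) : K) * sqm by
        push_cast; ring, this]
      push_cast
      linear_combination v ^ 2 / 4 * hNQ
  · have hint : IsIntegral ℤ sqm := by
      refine ⟨Polynomial.X ^ 2 - Polynomial.C m, by monicity!, ?_⟩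
      simp only [Polynomial.eval₂_sub, Polynomial.eval₂_pow,
        Polynomial.eval₂_X, Polynomial.eval₂_C]
      rw [eq_intCast]
      linear_combination hsq
    refine core_aux (⟨sqm, hint⟩ : NumberField.RingOfIntegers K) 0 (-m) Δ ?_
      (by rw [hΔ]; ring) (by omega) hspan ?_ h'
    · change sqm ^ 2 = _
      push_cast; linear_combination hsq
    · intro u v
      change Algebra.norm ℚ ((u : K) + v * sqm) = _
      rw [hnorm]; push_cast; ring
end
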